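/- arXiv:2601.09904 — 12 statements merged into one kernel-verified Lean document; each statement's English description precedes it below -/
import Mathlib

section
/- Let m > 1 be an integer and let φ be a ZMod m-linear endomorphism of M := (Fin 2 → ZMod m) which is a distortion map for M, i.e. for every nonzero v ∈ M and every integer a one has φ v ≠ a • v. Then for every v ∈ M whose additive order equals m, the element e v (φ v) of ZMod m has additive order exactly m. (This is the distortion property of the modified Weil pairing e_{m,φ}(P,P), stated in the standard linear-algebra model of E[m].) -/
/-- A vector of additive order `m` in `(ZMod m)²` is unimodular. -/
theorem isCoprime_of_addOrderOf_eq {m : ℕ} (hm : 1 < m) {v : Fin 2 → ZMod m}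
    (hv : addOrderOf v = m) : IsCoprime (v 0) (v 1) := by
  have : NeZero m := ⟨by omega⟩
  set g := Nat.gcd (v 0).val (v 1).val with hg
  have hcop : Nat.Coprime g m := by
    obtain ⟨t, ht⟩ := Nat.gcd_dvd_right g m
    have hvanish : ∀ i, Nat.gcd g m ∣ (v i).val → t • v i = 0 := by
      rintro i ⟨s, hs⟩
      rw [← ZMod.natCast_zmod_val (v i), hs, nsmul_eq_mul, ← Nat.cast_mul,
        ZMod.natCast_eq_zero_iff]
      refine ⟨s, ?_⟩
      conv_rhs => rw [ht]
      ring
    have htv : t • v = 0 := by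
      ext i
      fin_cases i
      · exact hvanish 0 ((Nat.gcd_dvd_left g m).trans (Nat.gcd_dvd_left _ _))
      · exact hvanish 1 ((Nat.gcd_dvd_left g m).trans (Nat.gcd_dvd_right _ _))
    have hmt : m ∣ t := hv ▸ addOrderOf_dvd_of_nsmul_eq_zero htv
    have htpos : 0 < t := Nat.pos_of_ne_zero (by rintro rfl; omega)
    have hle := Nat.le_of_dvd htpos hmt
    have hgpos : 0 < Nat.gcd g m := Nat.gcd_pos_of_pos_right _ (by omega)
    change Nat.gcd g m = 1
    nlinarith
  have hunit := ZMod.coe_mul_inv_eq_one g hcop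
  have hbez := congrArg (Int.cast : ℤ → ZMod m) (Nat.gcd_eq_gcd_ab (v 0).val (v 1).val)
  rw [← hg] at hbez
  push_cast at hbez
  rw [ZMod.natCast_zmod_val, ZMod.natCast_zmod_val] at hbez
  refine ⟨Nat.gcdA (v 0).val (v 1).val * (g : ZMod m)⁻¹,
    Nat.gcdB (v 0).val (v 1).val * (g : ZMod m)⁻¹, ?_⟩
  linear_combination hunit - (g : ZMod m)⁻¹ * hbez

/-- A vector whose determinant with a unimodular vector `v` vanishes is a multiple of `v`. -/
theorem exists_eq_smul_of_det_eq_zero {R : Type*} [CommRing R] {v x : Fin 2 → R}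
    (hv : IsCoprime (v 0) (v 1)) (h : v 0 * x 1 - v 1 * x 0 = 0) : ∃ c : R, x = c • v := by
  obtain ⟨a, b, hab⟩ := hv
  refine ⟨a * x 0 + b * x 1, ?_⟩
  ext i
  fin_cases i <;> simp only [Fin.zero_eta, Fin.mk_one, Pi.smul_apply, smul_eq_mul]
  · linear_combination (-x 0) * hab - b * h
  · linear_combination (-x 1) * hab + a * h


/-- Distortion property of the modified Weil pairing `e_{m,φ}(P,P)`, in the
linear-algebra model of `E[m]`: here `M = (Fin 2 → ZMod m)` and
`e v w = v 0 * w 1 - v 1 * w 0` is the determinant pairing. -/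
theorem distortion_modified_weil_pairing
    (m : ℕ) (hm : 1 < m)
    (φ : (Fin 2 → ZMod m) →ₗ[ZMod m] (Fin 2 → ZMod m))
    (hφ : ∀ v : Fin 2 → ZMod m, v ≠ 0 → ∀ a : ℤ, φ v ≠ a • v)
    (v : Fin 2 → ZMod m) (hv : addOrderOf v = m) :
    addOrderOf (v 0 * (φ v) 1 - v 1 * (φ v) 0) = m := by
  have : NeZero m := ⟨by omega⟩
  set d := v 0 * (φ v) 1 - v 1 * (φ v) 0 with hd
  obtain ⟨t, ht⟩ : addOrderOf d ∣ m := addOrderOf_dvd_of_nsmul_eq_zero (by simp)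
  have hkd : addOrderOf d • d = 0 := addOrderOf_nsmul_eq_zero d
  set k := addOrderOf d
  by_contra hkm
  have htpos : 0 < t := Nat.pos_of_ne_zero (by rintro rfl; omega)
  have hkv : k • v ≠ 0 := by
    intro h
    exact hkm (Nat.dvd_antisymm ⟨t, ht⟩ (hv ▸ addOrderOf_dvd_of_nsmul_eq_zero h))
  obtain ⟨c, hc⟩ : ∃ c : ZMod m, φ (k • v) = c • v := by
    refine exists_eq_smul_of_det_eq_zero (isCoprime_of_addOrderOf_eq hm hv) ?_
    rw [map_nsmul]
    simp only [Pi.smul_apply, nsmul_eq_mul] at hkd ⊢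
    rw [hd] at hkd
    linear_combination hkd
  have hcv : c • v = c.val • v := by
    conv_lhs => rw [← ZMod.natCast_zmod_val c]
    exact Nat.cast_smul_eq_nsmul _ _ _
  have htc : (t * c.val) • v = 0 := by
    rw [mul_nsmul', ← hcv, ← hc, ← map_nsmul, ← mul_nsmul', mul_comm, ← ht]
    have hmv : m • v = 0 := addOrderOf_dvd_iff_nsmul_eq_zero.mp hv.dvd
    rw [hmv, map_zero]
  have hdvd : m ∣ t * c.val := hv.symm.dvd.trans (addOrderOf_dvd_of_nsmul_eq_zero htc)
  have htk : t * k ∣ t * c.val := (mul_comm t k ▸ ht.symm.dvd).trans hdvd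
  obtain ⟨s, hs⟩ := Nat.dvd_of_mul_dvd_mul_left htpos htk
  refine hφ (k • v) hkv s ?_
  rw [hc, hcv, hs, natCast_zsmul, ← mul_nsmul]
end

section
/- (Strong distortion.) Let m > 1 be a squarefree integer and let φ be a ZMod m-linear endomorphism of M := (Fin 2 → ZMod m) which is a distortion map for M (for every nonzero v ∈ M and every integer a, φ v ≠ a • v). Then for every divisor n of m and every v ∈ M whose additive order equals n, the element e v (φ v) of ZMod m has additive order exactly n. -/
/-- For squarefree `m`, the ring `ZMod m` is von Neumann regular. -/
theorem ZMod.exists_mul_mul_eq_self_of_squarefree {m : ℕ} (hm : Squarefree m) (x : ZMod m) :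
    ∃ u : ZMod m, u * x * x = x := by
  obtain ⟨y, rfl⟩ : ∃ y : ℕ, (y : ZMod m) = x := by
    have : NeZero m := ⟨hm.ne_zero⟩
    exact ZMod.natCast_zmod_surjective x
  have hg : Nat.gcd (y ^ 2) m ∣ y :=
    ((hm.squarefree_of_dvd (Nat.gcd_dvd_right _ _)).dvd_pow_iff_dvd two_ne_zero).1
      (Nat.gcd_dvd_left _ _)
  obtain ⟨k, hk⟩ := hg
  have hb := congrArg (Int.cast : ℤ → ZMod m) (Nat.gcd_eq_gcd_ab (y ^ 2) m)
  have hk' := congrArg (Nat.cast : ℕ → ZMod m) hk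
  push_cast at hb hk'
  rw [ZMod.natCast_self, zero_mul, add_zero] at hb
  rw [hb] at hk'
  refine ⟨(Nat.gcdA (y ^ 2) m : ZMod m) * k, ?_⟩
  linear_combination -hk'

/-- A distortion map over a von Neumann regular `ZMod m` does not send a nonzero vector to one
having vanishing determinant with it. -/
theorem eq_zero_of_distortion_of_det_eq_zero {m : ℕ} (hm : Squarefree m)
    (φ : (Fin 2 → ZMod m) →ₗ[ZMod m] (Fin 2 → ZMod m))
    (hφ : ∀ v : Fin 2 → ZMod m, v ≠ 0 → ∀ a : ℤ, φ v ≠ a • v)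
    (w : Fin 2 → ZMod m) (hw : w 0 * (φ w) 1 - w 1 * (φ w) 0 = 0) : w = 0 := by
  have key : ∀ i, w i = 0 := by
    intro i
    obtain ⟨u, hu⟩ := ZMod.exists_mul_mul_eq_self_of_squarefree hm (w i)
    by_contra hi
    obtain ⟨a, ha⟩ := ZMod.intCast_surjective (u * φ w i)
    refine hφ ((u * w i) • w) (fun h => hi ?_) a ?_
    · rw [← hu]
      exact congrFun h i
    · have hcross : ∀ j, w i * φ w j = φ w i * w j := by
        intro j
        fin_cases i <;> fin_cases j <;> simp only [Fin.zero_eta, Fin.mk_one] <;>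
          first | ring | linear_combination hw | linear_combination -hw
      ext j
      simp only [map_smul, Pi.smul_apply, smul_eq_mul, zsmul_eq_mul, ha]
      linear_combination u * u * w i * hcross j - u * φ w j * hu
  exact funext key

/-- Strong distortion property: for squarefree `m`, a distortion map for `M`
pairs each point of order `n ∣ m` with itself to an element of order `n`. -/
theorem strong_distortion
    (m : ℕ) (hm : 1 < m) (hsf : Squarefree m)
    (φ : (Fin 2 → ZMod m) →ₗ[ZMod m] (Fin 2 → ZMod m))
    (hφ : ∀ v : Fin 2 → ZMod m, v ≠ 0 → ∀ a : ℤ, φ v ≠ a • v)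
    (n : ℕ) (hn : n ∣ m)
    (v : Fin 2 → ZMod m) (hv : addOrderOf v = n) :
    addOrderOf (v 0 * (φ v) 1 - v 1 * (φ v) 0) = n := by
  subst hv
  apply Nat.dvd_antisymm
  · apply addOrderOf_dvd_of_nsmul_eq_zero
    have h := addOrderOf_nsmul_eq_zero v
    have h0 := congrFun h 0
    have h1 := congrFun h 1
    simp only [Pi.smul_apply, nsmul_eq_mul, Pi.zero_apply] at h0 h1 ⊢
    linear_combination φ v 1 * h0 - φ v 0 * h1
  · apply addOrderOf_dvd_of_nsmul_eq_zero
    apply eq_zero_of_distortion_of_det_eq_zero hsf φ hφ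
    have h := addOrderOf_nsmul_eq_zero (v 0 * (φ v) 1 - v 1 * (φ v) 0)
    generalize addOrderOf (v 0 * (φ v) 1 - v 1 * (φ v) 0) = d at h ⊢
    rw [map_nsmul]
    simp only [Pi.smul_apply, nsmul_eq_mul] at h ⊢
    linear_combination (d : ZMod m) * h
end

section
/- (Failure of strong distortion for non-squarefree m.) Let m > 1 be an integer and ℓ a prime with ℓ² ∣ m. Then for all vectors v, w ∈ (Fin 2 → ZMod m) with ℓ • v = 0 and ℓ • w = 0, the determinant pairing vanishes: e v w = 0. In particular, for any linear endomorphism φ of (Fin 2 → ZMod m) and any v of additive order ℓ, one has e v (φ v) = 0, so e v (φ v) does not have additive order ℓ even when φ v ∉ ⟨v⟩. -/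
/-- If `n ^ 2 ∣ m`, every `n`-torsion element of `ZMod m` is a multiple of `n`. -/
theorem ZMod.natCast_dvd_of_natCast_mul_eq_zero {m n : ℕ} (hn : n ≠ 0) (hdvd : n ^ 2 ∣ m)
    {a : ZMod m} (ha : (n : ZMod m) * a = 0) : (n : ZMod m) ∣ a := by
  obtain ⟨x, rfl⟩ := ZMod.intCast_surjective a
  have hm : (m : ℤ) ∣ n * x := by
    rw [← CharP.intCast_eq_zero_iff (ZMod m) m]
    exact_mod_cast ha
  have hsq : (n : ℤ) * n ∣ n * x := by
    rw [← sq]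
    exact (by exact_mod_cast hdvd : (n : ℤ) ^ 2 ∣ m).trans hm
  have hx : (n : ℤ) ∣ x := (mul_dvd_mul_iff_left (by exact_mod_cast hn)).mp hsq
  simpa using map_dvd (Int.castRingHom (ZMod m)) hx

/-- If `n ^ 2 ∣ m`, the product of two `n`-torsion elements of `ZMod m` vanishes. -/
theorem ZMod.mul_eq_zero_of_natCast_mul_eq_zero {m n : ℕ} (hn : n ≠ 0) (hdvd : n ^ 2 ∣ m)
    {a b : ZMod m} (ha : (n : ZMod m) * a = 0) (hb : (n : ZMod m) * b = 0) : a * b = 0 := by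
  obtain ⟨c, rfl⟩ := ZMod.natCast_dvd_of_natCast_mul_eq_zero hn hdvd ha
  rw [mul_right_comm, hb, zero_mul]

/-- Failure of strong distortion for non-squarefree `m`: if `ℓ² ∣ m`, the
determinant pairing vanishes on all `ℓ`-torsion vectors of `(Fin 2 → ZMod m)`. -/
theorem pairing_vanishes_on_ell_torsion
    (m : ℕ) (hm : 1 < m) (ℓ : ℕ) (hℓ : ℓ.Prime) (hdvd : ℓ ^ 2 ∣ m)
    (v w : Fin 2 → ZMod m) (hv : ℓ • v = 0) (hw : ℓ • w = 0) :
    v 0 * w 1 - v 1 * w 0 = 0 := by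
  have hv' (i : Fin 2) : (ℓ : ZMod m) * v i = 0 := by
    simpa [nsmul_eq_mul] using congrFun hv i
  have hw' (i : Fin 2) : (ℓ : ZMod m) * w i = 0 := by
    simpa [nsmul_eq_mul] using congrFun hw i
  rw [ZMod.mul_eq_zero_of_natCast_mul_eq_zero hℓ.ne_zero hdvd (hv' 0) (hw' 1),
    ZMod.mul_eq_zero_of_natCast_mul_eq_zero hℓ.ne_zero hdvd (hv' 1) (hw' 0), sub_zero]
end

section
/- (Nondegeneracy of the modified Weil pairing.) Let m > 1 be an integer and let φ be a ZMod m-linear endomorphism of M := (Fin 2 → ZMod m) which is a distortion map for M (for every nonzero v ∈ M and every integer a, φ v ≠ a • v). Then φ is bijective, and the modified pairing (P, Q) ↦ e P (φ Q) is nondegenerate in both arguments: if Q ∈ M satisfies e P (φ Q) = 0 for all P ∈ M then Q = 0, and if Q ∈ M satisfies e Q (φ P) = 0 for all P ∈ M then Q = 0. -/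
/-- Nondegeneracy of the modified Weil pairing: a distortion map `φ` for
`M = (Fin 2 → ZMod m)` is bijective and the pairing `(P, Q) ↦ e P (φ Q)` is
nondegenerate in both arguments. -/
theorem modified_weil_pairing_nondegenerate
    (m : ℕ) (hm : 1 < m)
    (φ : (Fin 2 → ZMod m) →ₗ[ZMod m] (Fin 2 → ZMod m))
    (hφ : ∀ v : Fin 2 → ZMod m, v ≠ 0 → ∀ a : ℤ, φ v ≠ a • v) :
    Function.Bijective φ ∧
    (∀ Q : Fin 2 → ZMod m,
      (∀ P : Fin 2 → ZMod m, P 0 * (φ Q) 1 - P 1 * (φ Q) 0 = 0) → Q = 0) ∧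
    (∀ Q : Fin 2 → ZMod m,
      (∀ P : Fin 2 → ZMod m, Q 0 * (φ P) 1 - Q 1 * (φ P) 0 = 0) → Q = 0) := by
  have : NeZero m := ⟨by omega⟩
  have hker : ∀ v, φ v = 0 → v = 0 := fun v hv => by
    by_contra h
    exact hφ v h 0 (by simpa using hv)
  have hinj : Function.Injective φ := (injective_iff_map_eq_zero φ).2 hker
  have hbij : Function.Bijective φ := Finite.injective_iff_bijective.1 hinj
  refine ⟨hbij, fun Q hQ => hker Q ?_, fun Q hQ => ?_⟩
  · have h0 := hQ ![1, 0]
    have h1 := hQ ![0, 1]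
    ext i
    fin_cases i <;> simp_all
  · obtain ⟨P₀, hP₀⟩ := hbij.2 ![1, 0]
    obtain ⟨P₁, hP₁⟩ := hbij.2 ![0, 1]
    have h0 := hQ P₀
    have h1 := hQ P₁
    rw [hP₀] at h0
    rw [hP₁] at h1
    ext i
    fin_cases i <;> simp_all
end

section
/- Let G be an additive commutative group, φ : G →+ G an additive endomorphism, and m > 1 an integer. Then the following are equivalent: (i) for every nonzero P ∈ G with m • P = 0 and every integer a, φ P ≠ a • P; (ii) for every prime ℓ dividing m, every nonzero P ∈ G with ℓ • P = 0 and every integer a, φ P ≠ a • P. (This is the lemma that φ is a distortion map for E[m] if and only if φ is a distortion map for E[ℓ] for every prime ℓ ∣ m.) -/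
/-- A nonzero element killed by `m` has a nonzero multiple killed by some prime divisor of `m`. -/
lemma exists_prime_dvd_nsmul_ne_zero {G : Type*} [AddCommGroup G] {m : ℕ} (hm : m ≠ 0) {P : G}
    (hP : P ≠ 0) (hmP : m • P = 0) :
    ∃ ℓ : ℕ, ℓ.Prime ∧ ℓ ∣ m ∧ ∃ k : ℕ, k • P ≠ 0 ∧ ℓ • k • P = 0 := by
  have hdvd : addOrderOf P ∣ m := addOrderOf_dvd_of_nsmul_eq_zero hmP
  have hne : addOrderOf P ≠ 1 := fun h => hP (AddMonoid.addOrderOf_eq_one_iff.mp h)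
  obtain ⟨ℓ, hℓ, k, hk⟩ := Nat.exists_prime_and_dvd hne
  refine ⟨ℓ, hℓ, (Dvd.intro k hk.symm).trans hdvd, k, fun hkP => ?_, ?_⟩
  · have hpos : 0 < addOrderOf P := Nat.pos_of_dvd_of_pos hdvd (Nat.pos_of_ne_zero hm)
    have hkpos : 0 < k := Nat.pos_of_ne_zero (by rintro rfl; simp [hk] at hpos)
    have hle := Nat.le_of_dvd hkpos (addOrderOf_dvd_of_nsmul_eq_zero hkP)
    nlinarith [hℓ.two_le]
  · rw [← mul_smul, ← hk, addOrderOf_nsmul_eq_zero]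

/-- `φ` is a distortion map for the `m`-torsion of `G` if and only if it is a
distortion map for the `ℓ`-torsion for every prime `ℓ ∣ m`. -/
theorem distortion_m_iff_distortion_primes
    (G : Type*) [AddCommGroup G] (φ : G →+ G) (m : ℕ) (hm : 1 < m) :
    (∀ P : G, P ≠ 0 → m • P = 0 → ∀ a : ℤ, φ P ≠ a • P) ↔
    (∀ ℓ : ℕ, ℓ.Prime → ℓ ∣ m →
      ∀ P : G, P ≠ 0 → ℓ • P = 0 → ∀ a : ℤ, φ P ≠ a • P) := by
  constructor
  · rintro h ℓ - ⟨k, rfl⟩ P hP hℓP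
    exact h P hP (by rw [mul_comm, mul_smul, hℓP, smul_zero])
  · intro h P hP hmP a ha
    obtain ⟨ℓ, hℓ, hℓm, k, hkP, hℓkP⟩ := exists_prime_dvd_nsmul_ne_zero (by lia) hP hmP
    exact h ℓ hℓ hℓm (k • P) hkP hℓkP a (by rw [map_nsmul, ha, smul_comm])
end

section
/- (Isogeny transfer of distortion maps, pairing version.) Let m > 1 be an integer, M := (Fin 2 → ZMod m), and e the determinant pairing on M. Let ψ, ψ̂, φ be ZMod m-linear endomorphisms of M and d an integer with gcd(d, m) = 1 such that ψ̂ (ψ x) = d • x for all x ∈ M and e (ψ x) y = e x (ψ̂ y) for all x, y ∈ M. If P ∈ M satisfies e P (φ P) ≠ 0 (as holds when P has additive order m and φ is a distortion map for P), then for every integer a one has ψ (φ (ψ̂ (ψ P))) ≠ a • ψ P; that is, ψ ∘ φ ∘ ψ̂ is a distortion map for ψ P. -/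
/-- Isogeny transfer of distortion maps, pairing version: if `ψ̂ ∘ ψ = [d]`
with `gcd(d, m) = 1`, `e (ψ x) y = e x (ψ̂ y)`, and `e P (φ P) ≠ 0`, then
`ψ ∘ φ ∘ ψ̂` is a distortion map for `ψ P`. -/
theorem isogeny_transfer_pairing
    (m : ℕ) (hm : 1 < m)
    (ψ ψhat φ : (Fin 2 → ZMod m) →ₗ[ZMod m] (Fin 2 → ZMod m))
    (d : ℤ) (hd : Int.gcd d (m : ℤ) = 1)
    (hdual : ∀ x : Fin 2 → ZMod m, ψhat (ψ x) = d • x)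
    (hadj : ∀ x y : Fin 2 → ZMod m,
      (ψ x) 0 * y 1 - (ψ x) 1 * y 0 = x 0 * (ψhat y) 1 - x 1 * (ψhat y) 0)
    (P : Fin 2 → ZMod m) (hP : P 0 * (φ P) 1 - P 1 * (φ P) 0 ≠ 0) :
    ∀ a : ℤ, ψ (φ (ψhat (ψ P))) ≠ a • ψ P := by
  intro a h
  have hunit : IsUnit (d : ZMod m) :=
    (ZMod.coe_int_isUnit_iff_isCoprime d m).2 (Int.isCoprime_iff_gcd_eq_one.2 hd).symm
  have key : d • d • φ P = a • d • P := by
    have := congrArg ψhat h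
    rwa [hdual, map_zsmul, hdual, map_zsmul] at this
  have h0 := congrFun key 0
  have h1 := congrFun key 1
  simp only [Pi.smul_apply] at h0 h1
  simp only [zsmul_eq_mul] at h0 h1
  apply hP
  rw [← hunit.mul_right_eq_zero, ← hunit.mul_right_eq_zero]
  linear_combination P 0 * h1 - P 1 * h0
end

section
/- (Isogeny transfer of distortion maps, group version.) Let m > 1 and d be integers with gcd(d, m) = 1, and let M₁, M₂ be additive commutative groups with m • x = 0 for all x ∈ M₁ and all x ∈ M₂. Let ψ : M₁ →+ M₂ and ψ̂ : M₂ →+ M₁ satisfy ψ̂ (ψ x) = d • x for all x ∈ M₁ and ψ (ψ̂ y) = d • y for all y ∈ M₂. If φ : M₁ →+ M₁ satisfies φ P ≠ a • P for every nonzero P ∈ M₁ and every integer a, then for every nonzero Q ∈ M₂ and every integer a one has ψ (φ (ψ̂ Q)) ≠ a • Q. (This is the corollary that ψ ∘ φ ∘ ψ̂ is a distortion map for E₂[m] whenever φ is a distortion map for E₁[m] and ψ is an isogeny of degree d coprime to m with dual ψ̂.) -/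
/-- In a group of exponent dividing `m`, an integer coprime to `m` acts invertibly. -/
theorem exists_zsmul_zsmul_eq_self_of_gcd_eq_one {M : Type*} [AddCommGroup M]
    {m : ℕ} {d : ℤ} (h : ∀ x : M, m • x = 0) (hd : Int.gcd d (m : ℤ) = 1) :
    ∃ u : ℤ, ∀ x : M, u • d • x = x := by
  obtain ⟨u, v, huv⟩ := Int.isCoprime_iff_gcd_eq_one.mpr hd
  refine ⟨u, fun x => ?_⟩
  calc u • d • x = (u * d + v * m) • x := by
        rw [add_smul, mul_smul, mul_smul, natCast_zsmul, h, smul_zero, add_zero]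
    _ = x := by rw [huv, one_smul]

/-- Isogeny transfer of distortion maps, group version: if `φ` is a distortion
map for `M₁ = E₁[m]` and `ψ` is (the restriction of) an isogeny of degree `d`
coprime to `m` with dual `ψ̂`, then `ψ ∘ φ ∘ ψ̂` is a distortion map for
`M₂ = E₂[m]`. -/
theorem isogeny_transfer_group
    (m : ℕ) (hm : 1 < m) (d : ℤ) (hd : Int.gcd d (m : ℤ) = 1)
    (M₁ M₂ : Type*) [AddCommGroup M₁] [AddCommGroup M₂]
    (h₁ : ∀ x : M₁, m • x = 0) (h₂ : ∀ x : M₂, m • x = 0)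
    (ψ : M₁ →+ M₂) (ψhat : M₂ →+ M₁)
    (hψ : ∀ x : M₁, ψhat (ψ x) = d • x) (hψ' : ∀ y : M₂, ψ (ψhat y) = d • y)
    (φ : M₁ →+ M₁) (hφ : ∀ P : M₁, P ≠ 0 → ∀ a : ℤ, φ P ≠ a • P) :
    ∀ Q : M₂, Q ≠ 0 → ∀ a : ℤ, ψ (φ (ψhat Q)) ≠ a • Q := by
  intro Q hQ a h
  obtain ⟨u, hu⟩ := exists_zsmul_zsmul_eq_self_of_gcd_eq_one h₁ hd
  obtain ⟨w, hw⟩ := exists_zsmul_zsmul_eq_self_of_gcd_eq_one h₂ hd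
  have hP : ψhat Q ≠ 0 := by
    intro h0
    apply hQ
    rw [← hw Q, ← hψ' Q, h0, map_zero, smul_zero]
  apply hφ (ψhat Q) hP (u * a)
  rw [mul_smul, ← map_zsmul ψhat a Q, ← h, hψ, hu]
end

section
/- (The trace map is a distortion map outside the Frobenius eigenspaces.) Let ℓ be a prime, V a module over ZMod ℓ, and A : V →ₗ[ZMod ℓ] V a linear endomorphism. Suppose u, w ∈ V are nonzero with A u = u and A w = q • w for some q ∈ ZMod ℓ with q ≠ 0 and q ≠ 1. Let k := orderOf q (the multiplicative order of q in ZMod ℓ) and T := ∑_{i ∈ Finset.range k} A^i. Then for all a, b ∈ ZMod ℓ with a ≠ 0 and b ≠ 0, the point P := a • u + b • w satisfies T P ≠ c • P for every c ∈ ZMod ℓ. -/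
/-- A geometric sum of powers of an endomorphism acts on an eigenvector by the geometric sum of
the powers of the eigenvalue. -/
theorem LinearMap.geom_sum_apply_of_apply_eq_smul {R M : Type*} [CommSemiring R]
    [AddCommMonoid M] [Module R M] {f : M →ₗ[R] M} {μ : R} {x : M} (hx : f x = μ • x) (n : ℕ) :
    (∑ i ∈ Finset.range n, f ^ i) x = (∑ i ∈ Finset.range n, μ ^ i) • x := by
  have hpow (i : ℕ) : (f ^ i) x = μ ^ i • x := by
    induction i with
    | zero => simp
    | succ i ih => rw [pow_succ', Module.End.mul_apply, ih, map_smul, hx, smul_smul, ← pow_succ]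
  simp [LinearMap.sum_apply, hpow, Finset.sum_smul]

/-- The sum of the powers of `q ≠ 1` over one period vanishes. -/
theorem geom_sum_orderOf_eq_zero {R : Type*} [Ring R] [IsDomain R] {q : R} (hq : q ≠ 1) :
    ∑ i ∈ Finset.range (orderOf q), q ^ i = 0 := by
  have h := geom_sum_mul q (orderOf q)
  rw [pow_orderOf_eq_one, sub_self] at h
  exact (mul_eq_zero.mp h).resolve_right (sub_ne_zero.mpr hq)

/-- The order of a nonzero element of `ZMod ℓ` is nonzero modulo `ℓ`. -/
theorem ZMod.orderOf_cast_ne_zero {ℓ : ℕ} [Fact (Nat.Prime ℓ)] {q : ZMod ℓ} (hq : q ≠ 0) :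
    (orderOf q : ZMod ℓ) ≠ 0 := by
  have hℓ := (Fact.out : Nat.Prime ℓ).two_le
  have hdvd := ZMod.orderOf_dvd_card_sub_one hq
  rw [Ne, ZMod.natCast_eq_zero_iff]
  intro h
  have := Nat.le_of_dvd (by omega) (h.trans hdvd)
  omega


/-- The trace map is a distortion map outside the Frobenius eigenspaces:
if `A u = u` and `A w = q • w` with `q ≠ 0, 1`, and `T = ∑_{i < orderOf q} A^i`,
then `T P ∉ ⟨P⟩` for every `P = a • u + b • w` with `a ≠ 0` and `b ≠ 0`. -/
theorem trace_map_distortion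
    (ℓ : ℕ) [Fact (Nat.Prime ℓ)]
    (V : Type*) [AddCommGroup V] [Module (ZMod ℓ) V]
    (A : V →ₗ[ZMod ℓ] V) (q : ZMod ℓ) (hq0 : q ≠ 0) (hq1 : q ≠ 1)
    (u w : V) (hu : u ≠ 0) (hw : w ≠ 0)
    (hAu : A u = u) (hAw : A w = q • w)
    (a b : ZMod ℓ) (ha : a ≠ 0) (hb : b ≠ 0) :
    ∀ c : ZMod ℓ,
      (∑ i ∈ Finset.range (orderOf q), A ^ i) (a • u + b • w) ≠
        c • (a • u + b • w) := by
  intro c h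
  rw [map_add, map_smul, map_smul,
    LinearMap.geom_sum_apply_of_apply_eq_smul (hAu.trans (one_smul _ u).symm),
    LinearMap.geom_sum_apply_of_apply_eq_smul hAw, geom_sum_orderOf_eq_zero hq1] at h
  simp only [one_pow, Finset.sum_const, Finset.card_range, nsmul_eq_mul, mul_one, zero_smul,
    smul_zero, add_zero] at h
  have hA := congrArg A h
  simp only [map_add, map_smul, hAu, hAw] at hA
  have hw0 : (c * b * (q - 1)) • w = 0 := by
    linear_combination (norm := module) h - hA
  obtain rfl : c = 0 := by
    simpa [hw, hb, sub_ne_zero.mpr hq1] using hw0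
  simp [ha, hu, ZMod.orderOf_cast_ne_zero hq0] at h
end

section
/- Let m be a positive natural number and A a 2×2 matrix over ZMod m. Then A has no eigenvector, i.e. for every nonzero v ∈ (Fin 2 → ZMod m) and every λ ∈ ZMod m one has A.mulVec v ≠ λ • v, if and only if det(λ • (1 : Matrix (Fin 2) (Fin 2) (ZMod m)) − A) is a unit of ZMod m for every λ ∈ ZMod m. -/
/-- Over a finite commutative ring, a square matrix has unit determinant if and only if it kills
no nonzero vector. -/
theorem isUnit_det_iff_forall_mulVec_ne_zero {n R : Type*} [Fintype n] [DecidableEq n]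
    [CommRing R] [Finite R] (M : Matrix n n R) :
    IsUnit M.det ↔ ∀ v : n → R, v ≠ 0 → M.mulVec v ≠ 0 := by
  rw [← Matrix.isUnit_iff_isUnit_det, ← Matrix.mulVec_surjective_iff_isUnit,
    ← Finite.injective_iff_surjective]
  change Function.Injective M.mulVecLin ↔ _
  rw [injective_iff_map_eq_zero]
  exact forall_congr' fun v => not_imp_not.symm

/-- A 2×2 matrix over `ZMod m` has no eigenvector if and only if
`det (λ • 1 - A)` is a unit for every `λ ∈ ZMod m`. -/
theorem no_eigenvector_iff_det_unit
    (m : ℕ) (hm : 0 < m) (A : Matrix (Fin 2) (Fin 2) (ZMod m)) :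
    (∀ v : Fin 2 → ZMod m, v ≠ 0 → ∀ lam : ZMod m, A.mulVec v ≠ lam • v) ↔
    (∀ lam : ZMod m,
      IsUnit (Matrix.det (lam • (1 : Matrix (Fin 2) (Fin 2) (ZMod m)) - A))) := by
  have : NeZero m := ⟨hm.ne'⟩
  simp only [isUnit_det_iff_forall_mulVec_ne_zero, Matrix.sub_mulVec, Matrix.smul_mulVec,
    Matrix.one_mulVec, ne_eq, sub_eq_zero]
  exact ⟨fun h lam v hv e => h v hv lam e.symm, fun h v hv lam e => h lam v hv e.symm⟩
end

section
/- For every positive natural number m there exists a 2×2 matrix A over ZMod m with no eigenvector: for every nonzero v ∈ (Fin 2 → ZMod m) and every λ ∈ ZMod m, A.mulVec v ≠ λ • v. (For odd prime powers one may take the companion matrix of x² − a with a a quadratic non-residue, for powers of 2 the companion matrix of x² − x − 1, and combine via the Chinese remainder theorem.) -/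
/-- Since `x ↦ x ^ 2 + x` identifies `0` and `-1`, it is not surjective on `ZMod p`. -/
theorem exists_sq_add_self_add_natCast_ne_zero (p : ℕ) [Fact p.Prime] :
    ∃ c : ℕ, ∀ x : ZMod p, x ^ 2 + x + (c : ZMod p) ≠ 0 := by
  have hsurj : ¬ Function.Surjective (fun x : ZMod p => x ^ 2 + x) := by
    intro h
    have h0 : (0 : ZMod p) = -1 := Finite.injective_iff_surjective.mpr h (by ring)
    exact one_ne_zero (neg_eq_zero.mp h0.symm)
  simp only [Function.Surjective, not_forall, not_exists] at hsurj
  obtain ⟨a, ha⟩ := hsurj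
  refine ⟨(-a).val, fun x hx => ha x ?_⟩
  rw [ZMod.natCast_zmod_val] at hx
  linear_combination hx

theorem exists_forall_isUnit_sq_add_self_add (m : ℕ) (hm : 0 < m) :
    ∃ c : ZMod m, ∀ x : ZMod m, IsUnit (x ^ 2 + x + c) := by
  have : NeZero m := ⟨hm.ne'⟩
  have hex : ∀ p : ℕ, ∃ c : ℕ, p.Prime → ∀ x : ZMod p, x ^ 2 + x + (c : ZMod p) ≠ 0 := by
    intro p
    by_cases hp : p.Prime
    · have : Fact p.Prime := ⟨hp⟩
      obtain ⟨c, hc⟩ := exists_sq_add_self_add_natCast_ne_zero p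
      exact ⟨c, fun _ => hc⟩
    · exact ⟨0, fun h => absurd h hp⟩
  choose a ha using hex
  obtain ⟨c, hc⟩ := Nat.chineseRemainderOfFinset a id m.primeFactors
    (fun p hp => (Nat.prime_of_mem_primeFactors hp).ne_zero)
    (fun p hp q hq hpq => (Nat.coprime_primes (Nat.prime_of_mem_primeFactors hp)
      (Nat.prime_of_mem_primeFactors hq)).mpr hpq)
  refine ⟨c, fun x => ?_⟩
  obtain ⟨n, rfl⟩ := ZMod.natCast_zmod_surjective x
  have hcop : (n ^ 2 + n + c).Coprime m := by
    refine Nat.coprime_of_dvd fun p hp hpn hpm => ?_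
    have hcp : (c : ZMod p) = a p :=
      (ZMod.natCast_eq_natCast_iff _ _ _).mpr (hc p (Nat.mem_primeFactors.mpr ⟨hp, hpm, hm.ne'⟩))
    refine ha p hp n ?_
    rw [← hcp]
    exact_mod_cast (ZMod.natCast_eq_zero_iff _ _).mpr hpn
  exact_mod_cast (ZMod.isUnit_iff_coprime _ _).mpr hcop

/-- The companion matrix of `X ^ 2 + X + c` has no eigenvector if this polynomial takes only
unit values. -/
theorem companion_mulVec_ne_smul {R : Type*} [CommRing R] {c : R}
    (hc : ∀ x : R, IsUnit (x ^ 2 + x + c)) {v : Fin 2 → R} (hv : v ≠ 0) (r : R) :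
    (!![0, 1; -c, -1] : Matrix (Fin 2) (Fin 2) R).mulVec v ≠ r • v := by
  intro h
  have h0 : v 1 = r * v 0 := by simpa [Matrix.mulVec, dotProduct] using congrFun h 0
  have h1 : -(c * v 0) + -v 1 = r * v 1 := by
    simpa [Matrix.mulVec, dotProduct] using congrFun h 1
  have hv0 : v 0 = 0 :=
    (hc r).mul_right_eq_zero.mp (by linear_combination -h1 - (r + 1) * h0)
  apply hv
  ext i
  fin_cases i
  · exact hv0
  · simp [h0, hv0]

/-- For every `m > 0` there exists a 2×2 matrix over `ZMod m` with no
eigenvector. -/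
theorem exists_matrix_no_eigenvector (m : ℕ) (hm : 0 < m) :
    ∃ A : Matrix (Fin 2) (Fin 2) (ZMod m),
      ∀ v : Fin 2 → ZMod m, v ≠ 0 → ∀ lam : ZMod m, A.mulVec v ≠ lam • v := by
  obtain ⟨c, hc⟩ := exists_forall_isUnit_sq_add_self_add m hm
  exact ⟨!![0, 1; -c, -1], fun v hv lam => companion_mulVec_ne_smul hc hv lam⟩
end

section
/- Let ℓ be an odd prime and A a 2×2 matrix over ZMod ℓ. Then the discriminant D := (Matrix.trace A)² − 4 * Matrix.det A is not a square in ZMod ℓ if and only if A has no eigenvector, i.e. for every nonzero v ∈ (Fin 2 → ZMod ℓ) and every c ∈ ZMod ℓ one has A.mulVec v ≠ c • v. (This is the inert case of the proposition on Legendre symbols: an endomorphism φ with (D_φ/ℓ) = −1 is a distortion map for all of E[ℓ].) -/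
namespace Matrix

variable {K : Type*} [Field K]

theorem exists_mulVec_eq_smul_iff_det_sub_smul_one {n : Type*} [Fintype n] [DecidableEq n]
    (A : Matrix n n K) (c : K) :
    (∃ v ≠ 0, A.mulVec v = c • v) ↔ (A - c • (1 : Matrix n n K)).det = 0 := by
  rw [← exists_mulVec_eq_zero_iff]
  simp only [sub_mulVec, smul_mulVec, one_mulVec, sub_eq_zero]

theorem det_sub_smul_one_fin_two (A : Matrix (Fin 2) (Fin 2) K) (c : K) :
    (A - c • (1 : Matrix (Fin 2) (Fin 2) K)).det = 1 * (c * c) + -A.trace * c + A.det := by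
  simp [det_fin_two, trace_fin_two]
  ring

theorem isSquare_discr_iff_exists_eigenvector [NeZero (2 : K)] (A : Matrix (Fin 2) (Fin 2) K) :
    IsSquare (A.trace ^ 2 - 4 * A.det) ↔ ∃ c : K, ∃ v ≠ 0, A.mulVec v = c • v := by
  have hD : A.trace ^ 2 - 4 * A.det = discrim 1 (-A.trace) A.det := by
    rw [discrim]
    ring
  simp only [exists_mulVec_eq_smul_iff_det_sub_smul_one, det_sub_smul_one_fin_two, hD]
  constructor
  · exact exists_quadratic_eq_zero one_ne_zero
  · rintro ⟨c, hc⟩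
    rw [discrim_eq_sq_of_quadratic_eq_zero hc]
    exact IsSquare.sq _

end Matrix

/-- Inert case: a 2×2 matrix over `ZMod ℓ` (ℓ an odd prime) has non-square
discriminant if and only if it has no eigenvector. -/
theorem discriminant_nonsquare_iff_no_eigenvector
    (ℓ : ℕ) [Fact (Nat.Prime ℓ)] (hodd : ℓ ≠ 2)
    (A : Matrix (Fin 2) (Fin 2) (ZMod ℓ)) :
    ¬ IsSquare ((Matrix.trace A) ^ 2 - 4 * Matrix.det A) ↔
    (∀ v : Fin 2 → ZMod ℓ, v ≠ 0 → ∀ c : ZMod ℓ, A.mulVec v ≠ c • v) := by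
  have : NeZero (2 : ZMod ℓ) :=
    ⟨Ring.two_ne_zero (by rwa [ZMod.ringChar_zmod_n])⟩
  rw [Matrix.isSquare_discr_iff_exists_eigenvector]
  push Not
  exact ⟨fun h v hv c => h c v hv, fun h c v hv => h v hv c⟩
end

section
/- Let m > 1 be an integer and A a 2×2 matrix over ℤ such that for every prime ℓ dividing m, the reduction of the discriminant (Matrix.trace A)² − 4 * Matrix.det A modulo ℓ is not a square in ZMod ℓ. Then the reduction of A modulo m has no eigenvector: for every nonzero v ∈ (Fin 2 → ZMod m) and every integer a, (A.map (Int.cast : ℤ → ZMod m)).mulVec v ≠ a • v. (This is the corollary that φ is a distortion map for E[m] if and only if (D_φ/ℓ) = −1 for every prime ℓ ∣ m, in its matrix form.) -/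
/-- If the discriminant of an integer 2×2 matrix `A` is a non-square modulo
every prime `ℓ ∣ m`, then the reduction of `A` modulo `m` has no eigenvector. -/
theorem distortion_for_Em_of_nonsquare_discriminants
    (m : ℕ) (hm : 1 < m) (A : Matrix (Fin 2) (Fin 2) ℤ)
    (h : ∀ ℓ : ℕ, ℓ.Prime → ℓ ∣ m →
      ¬ IsSquare ((((Matrix.trace A) ^ 2 - 4 * Matrix.det A : ℤ) : ZMod ℓ))) :
    ∀ v : Fin 2 → ZMod m, v ≠ 0 → ∀ a : ℤ,
      (A.map (Int.cast : ℤ → ZMod m)).mulVec v ≠ a • v := by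
  intro v hv a hav
  -- The value at `a` of the characteristic polynomial of `A`.
  set d : ℤ := (A 0 0 - a) * (A 1 1 - a) - A 0 1 * A 1 0 with hd
  have hcop : IsCoprime d (m : ℤ) := by
    rw [Int.isCoprime_iff_gcd_eq_one]
    refine Nat.coprime_of_dvd fun ℓ hℓ hℓd hℓm => ?_
    refine h ℓ hℓ hℓm ⟨((2 * a - A.trace : ℤ) : ZMod ℓ), ?_⟩
    have hzero : (d : ZMod ℓ) = 0 :=
      (ZMod.intCast_zmod_eq_zero_iff_dvd d ℓ).2 (Int.natCast_dvd.2 hℓd)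
    have hdisc : A.trace ^ 2 - 4 * A.det = (2 * a - A.trace) * (2 * a - A.trace) - 4 * d := by
      rw [Matrix.det_fin_two, Matrix.trace_fin_two, hd]
      ring
    rw [hdisc, Int.cast_sub, Int.cast_mul 4, hzero, mul_zero, sub_zero, Int.cast_mul]
  have hunit : IsUnit (d : ZMod m) := by
    obtain ⟨x, y, hxy⟩ := hcop
    have hxy' := congrArg (Int.cast : ℤ → ZMod m) hxy
    push_cast at hxy'
    rw [ZMod.natCast_self, mul_zero, add_zero] at hxy'
    exact IsUnit.of_mul_eq_one_right _ hxy'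
  have h0 := congrFun hav 0
  have h1 := congrFun hav 1
  simp only [Matrix.mulVec, dotProduct, Fin.sum_univ_two, Matrix.map_apply, Pi.smul_apply,
    zsmul_eq_mul] at h0 h1
  refine hv (funext fun i => hunit.mul_right_eq_zero.1 ?_)
  rw [hd]
  push_cast
  fin_cases i
  · change _ * v 0 = 0
    linear_combination ((A 1 1 : ZMod m) - a) * h0 - (A 0 1 : ZMod m) * h1
  · change _ * v 1 = 0
    linear_combination ((A 0 0 : ZMod m) - a) * h1 - (A 1 0 : ZMod m) * h0
end
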